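/- Truth-preserving correspondence: for every bi-valued Kripke-kios-model M all of whose choice partitions are finite, there exist a finite-choice bi-valued kiobt-model M^T and a function g mapping each world w of M to an index of M^T such that for every formula φ of L_R and every world w, M,w ⊨ φ if and only if M^T, g(w) ⊨ φ. -/

import Mathlib

namespace IEAUST

variable {Agent Mom : Type}

/-- Histories: maximal chains of moments. -/
abbrev Hist (lt : Mom → Mom → Prop) : Type _ := {s : Set Mom // IsMaxChain lt s}

/-- An index is a pair of a moment and a history passing through it. -/
structure Idx (lt : Mom → Mom → Prop) where
  mom : Mom
  hist : Hist lt
  mem : mom ∈ hist.val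

/-- The ex ante information set of an agent at an index. -/
def exAnte {lt : Mom → Mom → Prop} (epi : Agent → Idx lt → Idx lt → Prop)
    (a : Agent) (i : Idx lt) : Set (Idx lt) :=
  {j | ∃ (h'' : Hist lt) (p : j.mom ∈ h''.val), epi a i ⟨j.mom, h'', p⟩}

/-- A kiobt structure: branching time, choices, epistemic relations, intention
topologies and deontic value(s). -/
structure BiKiobtModel (Agent Mom : Type) (lt : Mom → Mom → Prop) where
  ags_fin : Finite Agent
  mom_ne : Nonempty Mom
  lt_irrefl : ∀ m, ¬ lt m m
  lt_trans : ∀ {m₁ m₂ m₃}, lt m₁ m₂ → lt m₂ m₃ → lt m₁ m₃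
  no_bb : ∀ {m₁ m₂ m}, lt m₁ m → lt m₂ m → m₁ = m₂ ∨ lt m₁ m₂ ∨ lt m₂ m₁
  Choice : Agent → Mom → Set (Set (Hist lt))
  choice_sub : ∀ a m, ∀ L ∈ Choice a m, ∀ h ∈ L, m ∈ (h : Hist lt).val
  choice_ne : ∀ a m, ∀ L ∈ Choice a m, L.Nonempty
  choice_cover : ∀ a m (h : Hist lt), m ∈ h.val → ∃ L ∈ Choice a m, h ∈ L
  choice_disj : ∀ a m, ∀ L ∈ Choice a m, ∀ L' ∈ Choice a m, ∀ h, h ∈ L → h ∈ L' → L = L'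
  nc : ∀ a m m', lt m m' → ∀ h h' : Hist lt, m ∈ h.val → m ∈ h'.val →
        m' ∈ h.val → m' ∈ h'.val → ∀ L ∈ Choice a m, h ∈ L → h' ∈ L
  ia : ∀ m (s : Agent → Set (Hist lt)), (∀ a, s a ∈ Choice a m) → (⋂ a, s a).Nonempty
  epi : Agent → Idx lt → Idx lt → Prop
  epi_equiv : ∀ a, Equivalence (epi a)
  oac : ∀ a (i j : Idx lt), epi a i j → ∀ L ∈ Choice a i.mom, i.hist ∈ L →
        ∀ h' ∈ L, ∀ p : i.mom ∈ (h' : Hist lt).val, epi a ⟨i.mom, h', p⟩ j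
  unifH : ∀ a (i j : Idx lt), epi a i j → ∀ (h' : Hist lt) (p : i.mom ∈ h'.val),
        ∃ (h'' : Hist lt) (q : j.mom ∈ h''.val), epi a ⟨i.mom, h', p⟩ ⟨j.mom, h'', q⟩
  tau : Agent → Idx lt → Set (Set (Idx lt))
  tau_sub : ∀ a i, ∀ U ∈ tau a i, U ⊆ exAnte epi a i
  tau_univ : ∀ a i, exAnte epi a i ∈ tau a i
  tau_empty : ∀ a i, (∅ : Set (Idx lt)) ∈ tau a i
  tau_inter : ∀ a i U V, U ∈ tau a i → V ∈ tau a i → U ∩ V ∈ tau a i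
  tau_sUnion : ∀ a i (S : Set (Set (Idx lt))), S ⊆ tau a i → ⋃₀ S ∈ tau a i
  tau_ci : ∀ a i U V, U ∈ tau a i → V ∈ tau a i → U.Nonempty → V.Nonempty → (U ∩ V).Nonempty
  tau_ki : ∀ a i j, exAnte epi a i = exAnte epi a j → tau a i = tau a j
  ValueO : Hist lt → ℝ
  ValueS : Hist lt → ℝ
  val : ℕ → Set (Idx lt)

variable {lt : Mom → Mom → Prop}

/-- The model is finite-choice if every choice partition has finitely many cells. -/
def FiniteChoice (M : BiKiobtModel Agent Mom lt) : Prop :=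
  ∀ a m, (M.Choice a m).Finite

/-- `State^m_β`. -/
def stateSet (M : BiKiobtModel Agent Mom lt) (b : Agent) (m : Mom) : Set (Set (Hist lt)) :=
  {S | ∃ s : Agent → Set (Hist lt), (∀ a, s a ∈ M.Choice a m) ∧
        S = ⋂ a ∈ {a : Agent | a ≠ b}, s a}

/-- `X ≤ Y` (ordering used for objective dominance). -/
def leVal (M : BiKiobtModel Agent Mom lt) (X Y : Set (Hist lt)) : Prop :=
  ∀ h ∈ X, ∀ h' ∈ Y, M.ValueO h ≤ M.ValueO h'

/-- `X ≤_s Y` (ordering used for subjective dominance). -/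
def leValS (M : BiKiobtModel Agent Mom lt) (X Y : Set (Hist lt)) : Prop :=
  ∀ h ∈ X, ∀ h' ∈ Y, M.ValueS h ≤ M.ValueS h'

/-- Objective dominance `L ≼ L'`. -/
def domO (M : BiKiobtModel Agent Mom lt) (a : Agent) (m : Mom) (L L' : Set (Hist lt)) : Prop :=
  ∀ S ∈ stateSet M a m, leVal M (L ∩ S) (L' ∩ S)

/-- Strict objective dominance `L ≺ L'`. -/
def sdomO (M : BiKiobtModel Agent Mom lt) (a : Agent) (m : Mom) (L L' : Set (Hist lt)) : Prop :=
  domO M a m L L' ∧ ¬ domO M a m L' L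

/-- `Optimal^m_α`. -/
def optimal (M : BiKiobtModel Agent Mom lt) (a : Agent) (m : Mom) : Set (Set (Hist lt)) :=
  {L | L ∈ M.Choice a m ∧ ¬ ∃ L' ∈ M.Choice a m, sdomO M a m L L'}

/-- `m ∼_α m'` for moments. -/
def momRel (M : BiKiobtModel Agent Mom lt) (a : Agent) (m m' : Mom) : Prop :=
  ∃ (i j : Idx lt), i.mom = m ∧ j.mom = m' ∧ M.epi a i j

/-- The epistemic cluster `[L]^m_α` of `L ⊆ H_{m*}` at `m`. -/
def cluster (M : BiKiobtModel Agent Mom lt) (a : Agent) (mstar : Mom)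
    (L : Set (Hist lt)) (m : Mom) : Set (Hist lt) :=
  {h | ∃ (p : m ∈ h.val) (hs : Hist lt), hs ∈ L ∧
        ∃ q : mstar ∈ hs.val, M.epi a ⟨mstar, hs, q⟩ ⟨m, h, p⟩}

/-- Subjective dominance `L ≼_s L'`. -/
def domS (M : BiKiobtModel Agent Mom lt) (a : Agent) (mstar : Mom)
    (L L' : Set (Hist lt)) : Prop :=
  ∀ m, momRel M a mstar m → ∀ S ∈ stateSet M a m,
    leValS M (cluster M a mstar L m ∩ S) (cluster M a mstar L' m ∩ S)

/-- Strict subjective dominance `L ≺_s L'`. -/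
def sdomS (M : BiKiobtModel Agent Mom lt) (a : Agent) (mstar : Mom)
    (L L' : Set (Hist lt)) : Prop :=
  domS M a mstar L L' ∧ ¬ domS M a mstar L' L

/-- `SOptimal^m_α`. -/
def soptimal (M : BiKiobtModel Agent Mom lt) (a : Agent) (m : Mom) : Set (Set (Hist lt)) :=
  {L | L ∈ M.Choice a m ∧ ¬ ∃ L' ∈ M.Choice a m, sdomS M a m L L'}

/-- Formulas of the language `L_R` (atomic propositions indexed by `ℕ`). -/
inductive Formula (Agent : Type) : Type
  | atom : ℕ → Formula Agent
  | neg : Formula Agent → Formula Agent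
  | conj : Formula Agent → Formula Agent → Formula Agent
  | box : Formula Agent → Formula Agent
  | stit : Agent → Formula Agent → Formula Agent
  | know : Agent → Formula Agent → Formula Agent
  | intend : Agent → Formula Agent → Formula Agent
  | oughtO : Agent → Formula Agent → Formula Agent
  | oughtS : Agent → Formula Agent → Formula Agent

/-- `◇φ := ¬□¬φ`. -/
def Formula.diam (φ : Formula Agent) : Formula Agent := .neg (.box (.neg φ))

/-- Material implication `φ → ψ := ¬(φ ∧ ¬ψ)`. -/
def Formula.imp (φ ψ : Formula Agent) : Formula Agent := .neg (.conj φ (.neg ψ))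

/-- Truth at an index of a (finite-choice) kiobt-model. -/
def truth (M : BiKiobtModel Agent Mom lt) : Formula Agent → Idx lt → Prop
  | .atom n, i => i ∈ M.val n
  | .neg φ, i => ¬ truth M φ i
  | .conj φ ψ, i => truth M φ i ∧ truth M ψ i
  | .box φ, i => ∀ (h' : Hist lt) (p : i.mom ∈ h'.val), truth M φ ⟨i.mom, h', p⟩
  | .stit a φ, i => ∀ L ∈ M.Choice a i.mom, i.hist ∈ L →
      ∀ h' ∈ L, ∀ p : i.mom ∈ (h' : Hist lt).val, truth M φ ⟨i.mom, h', p⟩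
  | .know a φ, i => ∀ j, M.epi a i j → truth M φ j
  | .intend a φ, i => ∃ U ∈ M.tau a i, U.Nonempty ∧ ∀ j ∈ U, truth M φ j
  | .oughtO a φ, i => ∀ L ∈ optimal M a i.mom, ∀ h' ∈ L,
      ∀ p : i.mom ∈ (h' : Hist lt).val, truth M φ ⟨i.mom, h', p⟩
  | .oughtS a φ, i => ∀ L ∈ soptimal M a i.mom, ∀ m', momRel M a i.mom m' →
      ∀ h' ∈ cluster M a i.mom L m', ∀ p : m' ∈ (h' : Hist lt).val, truth M φ ⟨m', h', p⟩

/-- A bi-valued Kripke-kios-model. -/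
structure KripkeModel (Agent : Type) where
  W : Type
  ags_fin : Finite Agent
  rbox : W → W → Prop
  rbox_equiv : Equivalence rbox
  Choice : Agent → W → Set (Set W)
  choice_congr : ∀ a w v, rbox w v → Choice a w = Choice a v
  choice_sub : ∀ a w, ∀ L ∈ Choice a w, ∀ u ∈ L, rbox w u
  choice_ne : ∀ a w, ∀ L ∈ Choice a w, L.Nonempty
  choice_cover : ∀ a w v, rbox w v → ∃ L ∈ Choice a w, v ∈ L
  choice_disj : ∀ a w, ∀ L ∈ Choice a w, ∀ L' ∈ Choice a w, ∀ v, v ∈ L → v ∈ L' → L = L'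
  ia : ∀ w (s : Agent → Set W), (∀ a, s a ∈ Choice a w) → (⋂ a, s a).Nonempty
  aeq : Agent → W → W → Prop
  aeq_equiv : ∀ a, Equivalence (aeq a)
  oacK : ∀ a v, ∀ L ∈ Choice a v, v ∈ L → ∀ u ∈ L, aeq a v u
  unifHK : ∀ a v u, aeq a v u → ∀ v', rbox v v' → ∃ u', rbox u u' ∧ aeq a v' u'
  ri : Agent → W → W → Prop
  ri_serial : ∀ a w, ∃ v, ri a w v
  ri_trans : ∀ a {x y z}, ri a x y → ri a y z → ri a x z
  ri_eucl : ∀ a {x y z}, ri a x y → ri a x z → ri a y z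
  ri_sub : ∀ a {x y}, ri a x y → ∃ z, aeq a x z ∧ rbox z y
  denK : ∀ a v u, (∃ y, aeq a v y ∧ rbox y u) → ∃ z, ri a v z ∧ ri a u z
  ValueO : W → ℝ
  ValueS : W → ℝ
  val : ℕ → Set W

/-- `State^w̄_β` in a Kripke-kios-model. -/
def kState (M : KripkeModel Agent) (b : Agent) (w : M.W) : Set (Set M.W) :=
  {S | ∃ s : Agent → Set M.W, (∀ a, s a ∈ M.Choice a w) ∧
        S = ⋂ a ∈ {a : Agent | a ≠ b}, s a}

/-- `X ≤ Y` via `Value_O`. -/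
def kleO (M : KripkeModel Agent) (X Y : Set M.W) : Prop :=
  ∀ x ∈ X, ∀ y ∈ Y, M.ValueO x ≤ M.ValueO y

/-- `X ≤_s Y` via `Value_S`. -/
def kleS (M : KripkeModel Agent) (X Y : Set M.W) : Prop :=
  ∀ x ∈ X, ∀ y ∈ Y, M.ValueS x ≤ M.ValueS y

/-- Objective dominance `L ≼ L'` in a Kripke-kios-model. -/
def kdom (M : KripkeModel Agent) (a : Agent) (w : M.W) (L L' : Set M.W) : Prop :=
  ∀ S ∈ kState M a w, kleO M (L ∩ S) (L' ∩ S)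

/-- The epistemic cluster `⟦L⟧^v̄_α`. -/
def kcluster (M : KripkeModel Agent) (a : Agent) (L : Set M.W) (v : M.W) : Set M.W :=
  {u | M.rbox v u ∧ ∃ o ∈ L, M.aeq a o u}

/-- Subjective dominance `L ≼_s L'` in a Kripke-kios-model. -/
def kdomS (M : KripkeModel Agent) (a : Agent) (w : M.W) (L L' : Set M.W) : Prop :=
  ∀ v, M.aeq a w v → ∀ S ∈ kState M a v,
    kleS M (kcluster M a L v ∩ S) (kcluster M a L' v ∩ S)

/-- Truth at a world of a bi-valued Kripke-kios-model. -/
def ktruth (M : KripkeModel Agent) : Formula Agent → M.W → Prop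
  | .atom n, w => w ∈ M.val n
  | .neg φ, w => ¬ ktruth M φ w
  | .conj φ ψ, w => ktruth M φ w ∧ ktruth M ψ w
  | .box φ, w => ∀ v, M.rbox w v → ktruth M φ v
  | .stit a φ, w => ∀ L ∈ M.Choice a w, w ∈ L → ∀ v ∈ L, ktruth M φ v
  | .know a φ, w => ∀ v, M.aeq a w v → ktruth M φ v
  | .intend a φ, w => ∃ x, (∃ y, M.aeq a w y ∧ M.rbox y x) ∧
      ∀ v, (x = v ∨ M.ri a x v) → ktruth M φ v
  | .oughtO a φ, w => ∀ L ∈ M.Choice a w, (∃ v ∈ L, ¬ ktruth M φ v) →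
      ∃ L' ∈ M.Choice a w, (kdom M a w L L' ∧ ¬ kdom M a w L' L) ∧
        ∀ L'' ∈ M.Choice a w, (L'' = L' ∨ kdom M a w L' L'') → ∀ u ∈ L'', ktruth M φ u
  | .oughtS a φ, w => ∀ L ∈ M.Choice a w,
      (∃ w', M.aeq a w w' ∧ ∃ v ∈ kcluster M a L w', ¬ ktruth M φ v) →
      ∃ L' ∈ M.Choice a w, (kdomS M a w L L' ∧ ¬ kdomS M a w L' L) ∧
        ∀ L'' ∈ M.Choice a w, (L'' = L' ∨ kdomS M a w L' L'') →
          ∀ w'', (∃ x, M.rbox w x ∧ ∃ y, M.rbox w'' y ∧ M.aeq a x y) →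
            ∀ u ∈ kcluster M a L'' w'', ktruth M φ u

theorem Idx.eq_of_mom_hist {i j : Idx lt} (hm : i.mom = j.mom) (hh : i.hist = j.hist) :
    i = j := by
  cases i; cases j; subst hm; subst hh; rfl

/-- For a relation transitive on a finite set, all maximal elements satisfy `P` iff every element
violating `P` is strictly dominated by some element satisfying `P` along with all of its
dominators. -/
theorem forall_dominated_iff_forall_maximal {X : Type*} {C : Set X} (hC : C.Finite)
    {r : X → X → Prop}
    (hr : ∀ x ∈ C, ∀ y ∈ C, ∀ z ∈ C, r x y → r y z → r x z) (P : X → Prop) :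
    (∀ x ∈ C, ¬ P x → ∃ y ∈ C, (r x y ∧ ¬ r y x) ∧ ∀ z ∈ C, (z = y ∨ r y z) → P z) ↔
      ∀ x ∈ C, (¬ ∃ y ∈ C, r x y ∧ ¬ r y x) → P x := by
  constructor
  · intro h x hx hmax
    by_contra hP
    obtain ⟨y, hy, hxy, -⟩ := h x hx hP
    exact hmax ⟨y, hy, hxy⟩
  · intro h x hx hP
    let D : Set C := {y | r x y ∧ ¬ r y x}
    let s : C → C → Prop := fun y z => r z y ∧ ¬ r y z
    have : Finite C := hC
    have : IsTrans C s := ⟨fun u v w huv hvw =>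
      ⟨hr _ w.2 _ v.2 _ u.2 hvw.1 huv.1,
        fun hc => huv.2 (hr _ u.2 _ w.2 _ v.2 hc hvw.1)⟩⟩
    have : Std.Irrefl s := ⟨fun u hu => hu.2 hu.1⟩
    have hwf : WellFounded s := Finite.wellFounded_of_trans_of_irrefl s
    have hD : D.Nonempty := by
      by_contra hne
      refine hP (h x hx ?_)
      rintro ⟨y, hy, hxy⟩
      exact hne ⟨⟨y, hy⟩, hxy⟩
    obtain ⟨⟨y, hy⟩, hyD, hymin⟩ := hwf.has_min D hD
    have hmax : ∀ z ∈ C, r y z → r z y := by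
      intro z hz hyz
      by_contra hzy
      refine hymin ⟨z, hz⟩ ⟨hr _ hx _ hy _ hz hyD.1 hyz, ?_⟩ ⟨hyz, hzy⟩
      exact fun hzx => hzy (hr _ hz _ hx _ hy hzx hyD.1)
    refine ⟨y, hy, hyD, ?_⟩
    rintro z hz (rfl | hyz)
    · exact h z hz fun ⟨u, hu, hzu, huz⟩ => huz (hmax u hu hzu)
    · refine h z hz fun ⟨u, hu, hzu, huz⟩ => huz ?_
      exact hr _ hu _ hy _ hz (hmax u hu (hr _ hy _ hz _ hu hyz hzu)) hyz

namespace KripkeModel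

variable (M : KripkeModel Agent)

section Kripke

variable {M} {a : Agent} {w v : M.W}

theorem inter_kState_nonempty {K S : Set M.W} (hK : K ∈ M.Choice a w) (hS : S ∈ kState M a w) :
    (K ∩ S).Nonempty := by
  classical
  obtain ⟨s, hs, rfl⟩ := hS
  obtain ⟨x, hx⟩ := M.ia w (Function.update s a K) fun b => by
    by_cases hb : b = a
    · subst hb; simpa using hK
    · simpa [hb] using hs b
  rw [Set.mem_iInter] at hx
  refine ⟨x, by simpa using hx a, ?_⟩
  simp only [Set.mem_iInter, Set.mem_ofPred_eq]
  intro b hb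
  simpa [hb] using hx b

theorem kcluster_inter_kState_nonempty {K S : Set M.W} (hK : K ∈ M.Choice a w)
    (hwv : M.aeq a w v) (hS : S ∈ kState M a v) : (kcluster M a K v ∩ S).Nonempty := by
  obtain ⟨o, ho⟩ := M.choice_ne a w K hK
  obtain ⟨u, hvu, hou⟩ := M.unifHK a w v hwv o (M.choice_sub a w K hK o ho)
  obtain ⟨L, hL, huL⟩ := M.choice_cover a v u hvu
  obtain ⟨x, hxL, hxS⟩ := inter_kState_nonempty hL hS
  refine ⟨x, ⟨M.choice_sub a v L hL x hxL, o, ho, (M.aeq_equiv a).trans hou ?_⟩, hxS⟩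
  exact M.oacK a u L (M.choice_congr a v u hvu ▸ hL) huL x hxL

theorem kdom_trans {K₁ K₂ K₃ : Set M.W} (h₂ : K₂ ∈ M.Choice a w)
    (h₁₂ : kdom M a w K₁ K₂) (h₂₃ : kdom M a w K₂ K₃) : kdom M a w K₁ K₃ := by
  intro S hS x hx z hz
  obtain ⟨y, hy⟩ := inter_kState_nonempty h₂ hS
  exact (h₁₂ S hS x hx y hy).trans (h₂₃ S hS y hy z hz)

theorem kdomS_trans {K₁ K₂ K₃ : Set M.W} (h₂ : K₂ ∈ M.Choice a w)
    (h₁₂ : kdomS M a w K₁ K₂) (h₂₃ : kdomS M a w K₂ K₃) : kdomS M a w K₁ K₃ := by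
  intro v hv S hS x hx z hz
  obtain ⟨y, hy⟩ := kcluster_inter_kState_nonempty h₂ hv hS
  exact (h₁₂ v hv S hS x hx y hy).trans (h₂₃ v hv S hS y hy z hz)

theorem kcluster_congr {K : Set M.W} (h : M.rbox w v) : kcluster M a K w = kcluster M a K v := by
  ext u
  exact and_congr_left' ⟨M.rbox_equiv.trans (M.rbox_equiv.symm h), M.rbox_equiv.trans h⟩

theorem exists_aeq_of_rbox_aeq_rbox {w'' : M.W}
    (h : ∃ x, M.rbox w x ∧ ∃ y, M.rbox w'' y ∧ M.aeq a x y) :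
    ∃ v, M.aeq a w v ∧ M.rbox v w'' := by
  obtain ⟨x, hx, y, hy, hxy⟩ := h
  obtain ⟨v, hv, hwv⟩ := M.unifHK a x y hxy w (M.rbox_equiv.symm hx)
  exact ⟨v, hwv, M.rbox_equiv.symm (M.rbox_equiv.trans hy hv)⟩

theorem ktruth_oughtO_iff (hfc : ∀ a w, (M.Choice a w).Finite) (φ : Formula Agent) :
    ktruth M (.oughtO a φ) w ↔ ∀ K ∈ M.Choice a w,
      (¬ ∃ K' ∈ M.Choice a w, kdom M a w K K' ∧ ¬ kdom M a w K' K) →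
        ∀ v ∈ K, ktruth M φ v := by
  rw [← forall_dominated_iff_forall_maximal (hfc a w) (r := kdom M a w)
    (fun x _ y hy z _ => kdom_trans hy) (fun K => ∀ v ∈ K, ktruth M φ v)]
  simp only [not_forall, exists_prop, ktruth]

theorem ktruth_oughtS_iff (hfc : ∀ a w, (M.Choice a w).Finite) (φ : Formula Agent) :
    ktruth M (.oughtS a φ) w ↔ ∀ K ∈ M.Choice a w,
      (¬ ∃ K' ∈ M.Choice a w, kdomS M a w K K' ∧ ¬ kdomS M a w K' K) →
        ∀ w', M.aeq a w w' → ∀ v ∈ kcluster M a K w', ktruth M φ v := by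
  rw [← forall_dominated_iff_forall_maximal (hfc a w) (r := kdomS M a w)
    (fun x _ y hy z _ => kdomS_trans hy)
    (fun K => ∀ w', M.aeq a w w' → ∀ v ∈ kcluster M a K w', ktruth M φ v)]
  have key : ∀ K : Set M.W,
      (∀ w'', (∃ x, M.rbox w x ∧ ∃ y, M.rbox w'' y ∧ M.aeq a x y) →
        ∀ u ∈ kcluster M a K w'', ktruth M φ u) ↔
      ∀ w', M.aeq a w w' → ∀ v ∈ kcluster M a K w', ktruth M φ v := by
    intro K
    constructor
    · intro h w' hw'
      exact h w' ⟨w, M.rbox_equiv.refl w, w', M.rbox_equiv.refl w', hw'⟩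
    · intro h w'' hw''
      obtain ⟨v, hv, hvw⟩ := exists_aeq_of_rbox_aeq_rbox hw''
      rw [← kcluster_congr hvw]
      exact h v hv
  simp only [ktruth, key, not_forall, exists_prop]

end Kripke

/-- The equivalence underlying historical necessity. -/
def boxSetoid : Setoid M.W := ⟨M.rbox, M.rbox_equiv⟩

/-- Moments of the two-level tree over a Kripke model: a root for every class of worlds, and a
leaf for every world. -/
abbrev Moment : Type := Quotient M.boxSetoid ⊕ M.W

/-- The root below the leaf of a world. -/
def root (w : M.W) : M.Moment := .inl (Quotient.mk M.boxSetoid w)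

/-- Each leaf lies above the root of its class. -/
def Precedes (m m' : M.Moment) : Prop := ∃ w, m = M.root w ∧ m' = .inr w

variable {M}

theorem root_eq_root {w v : M.W} : M.root w = M.root v ↔ M.rbox w v := by
  rw [root, root, Sum.inl.injEq]
  exact Quotient.eq

variable (M)

/-- The history through the leaf of a world. -/
def history (w : M.W) : Hist M.Precedes := by
  refine ⟨{M.root w, .inr w}, ?_, ?_⟩
  · rintro x (rfl | rfl) y (rfl | rfl) hne
    · exact (hne rfl).elim
    · exact .inl ⟨w, rfl, rfl⟩
    · exact .inr ⟨w, rfl, rfl⟩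
    · exact (hne rfl).elim
  · intro t ht hsub
    refine hsub.antisymm fun x hx => ?_
    by_cases hxw : x = .inr w
    · exact .inr hxw
    · rcases ht hx (hsub (.inr rfl)) hxw with ⟨v, rfl, hv⟩ | ⟨v, hv, -⟩
      · cases hv; exact .inl rfl
      · cases hv

variable {M}

theorem root_mem_history {w v : M.W} : M.root w ∈ (M.history v).val ↔ M.rbox w v := by
  rw [← root_eq_root]
  constructor
  · rintro (h | h)
    · exact h
    · cases h
  · exact fun h => .inl h

theorem leaf_mem_history {w v : M.W} : .inr w ∈ (M.history v).val ↔ w = v := by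
  constructor
  · rintro (h | h)
    · cases h
    · cases h; rfl
  · rintro rfl; exact .inr rfl

theorem history_injective : Function.Injective M.history := fun w v h => by
  rw [← leaf_mem_history, ← h, leaf_mem_history]

theorem history_surjective [Nonempty M.W] : Function.Surjective M.history := by
  rintro ⟨c, hc⟩
  suffices h : ∃ w, c ⊆ (M.history w).val by
    obtain ⟨w, hw⟩ := h
    exact ⟨w, Subtype.ext (hc.2 (M.history w).2.1 hw).symm⟩
  by_cases hleaf : ∃ w, Sum.inr w ∈ c
  · obtain ⟨w, hw⟩ := hleaf
    refine ⟨w, fun x hx => ?_⟩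
    by_cases hxw : x = .inr w
    · exact .inr hxw
    · rcases hc.1 hx hw hxw with ⟨v, rfl, hv⟩ | ⟨v, hv, -⟩
      · cases hv; exact .inl rfl
      · cases hv
  · have hroot : ∀ x ∈ c, ∃ w, x = M.root w := by
      rintro (q | w) hx
      · obtain ⟨w, rfl⟩ := Quotient.exists_rep q
        exact ⟨w, rfl⟩
      · exact (hleaf ⟨w, hx⟩).elim
    rcases c.eq_empty_or_nonempty with rfl | ⟨x, hx⟩
    · exact ⟨Classical.arbitrary _, Set.empty_subset _⟩
    · obtain ⟨w, rfl⟩ := hroot x hx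
      refine ⟨w, fun y hy => ?_⟩
      by_cases hyw : y = M.root w
      · exact .inl hyw
      · rcases hc.1 hy hx hyw with ⟨v, -, hv⟩ | ⟨v, -, hv⟩
        · cases hv
        · exact (hleaf ⟨v, hv ▸ hy⟩).elim

theorem exists_history_of_root_mem [Nonempty M.W] {w : M.W} {h : Hist M.Precedes}
    (p : M.root w ∈ h.val) : ∃ v, M.rbox w v ∧ h = M.history v := by
  obtain ⟨v, rfl⟩ := history_surjective h
  exact ⟨v, root_mem_history.1 p, rfl⟩

theorem eq_history_of_leaf_mem [Nonempty M.W] {w : M.W} {h : Hist M.Precedes}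
    (p : .inr w ∈ h.val) : h = M.history w := by
  obtain ⟨v, rfl⟩ := history_surjective h
  rw [leaf_mem_history.1 p]

variable (M)

/-- The index of a world: the root of its class together with the history of the world. -/
def idx (w : M.W) : Idx M.Precedes :=
  ⟨M.root w, M.history w, root_mem_history.2 (M.rbox_equiv.refl w)⟩

/-- The index at the leaf of a world. -/
def leafIdx (w : M.W) : Idx M.Precedes := ⟨.inr w, M.history w, leaf_mem_history.2 rfl⟩

variable {M}

theorem idx_injective : Function.Injective M.idx := fun _ _ h =>
  history_injective (congrArg Idx.hist h)

theorem mk_root_history {w v : M.W} (p : M.root w ∈ (M.history v).val) :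
    (⟨M.root w, M.history v, p⟩ : Idx M.Precedes) = M.idx v :=
  Idx.eq_of_mom_hist (root_eq_root.2 (root_mem_history.1 p)) rfl

theorem idx_ne_leafIdx {w v : M.W} : M.idx w ≠ M.leafIdx v := fun h => by
  have := congrArg Idx.mom h
  cases this

theorem eq_leafIdx_of_mom [Nonempty M.W] {i : Idx M.Precedes} {w : M.W} (h : i.mom = .inr w) :
    i = M.leafIdx w := by
  refine Idx.eq_of_mom_hist h (eq_history_of_leaf_mem ?_)
  rw [← h]; exact i.mem

theorem eq_idx_of_mom [Nonempty M.W] {i : Idx M.Precedes} {w : M.W} (h : i.mom = M.root w) :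
    ∃ v, M.rbox w v ∧ i = M.idx v := by
  obtain ⟨m, h', p⟩ := i
  obtain rfl : m = M.root w := h
  obtain ⟨v, hv, rfl⟩ := exists_history_of_root_mem p
  exact ⟨v, hv, mk_root_history p⟩

theorem moment_cases (m : M.Moment) : (∃ w, m = M.root w) ∨ ∃ w, m = .inr w := by
  rcases m with q | w
  · obtain ⟨w, rfl⟩ := Quotient.exists_rep q
    exact .inl ⟨w, rfl⟩
  · exact .inr ⟨w, rfl⟩

theorem idx_cases [Nonempty M.W] (i : Idx M.Precedes) :
    (∃ w, i = M.idx w) ∨ ∃ w, i = M.leafIdx w := by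
  rcases moment_cases i.mom with ⟨w, hw⟩ | ⟨w, hw⟩
  · obtain ⟨v, -, hv⟩ := eq_idx_of_mom hw
    exact .inl ⟨v, hv⟩
  · exact .inr ⟨w, eq_leafIdx_of_mom hw⟩

theorem forall_at_root [Nonempty M.W] {w : M.W} {P : Idx M.Precedes → Prop} :
    (∀ (h : Hist M.Precedes) (p : M.root w ∈ h.val), P ⟨M.root w, h, p⟩) ↔
      ∀ v, M.rbox w v → P (M.idx v) := by
  constructor
  · intro H v hv
    rw [← mk_root_history (root_mem_history.2 hv)]
    exact H _ _
  · intro H h p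
    obtain ⟨v, hv, rfl⟩ := exists_history_of_root_mem p
    rw [mk_root_history]
    exact H v hv

variable (M)

/-- Choices at a moment: those of the Kripke model at roots, and the trivial ones at leaves. -/
def treeChoice (a : Agent) (m : M.Moment) : Set (Set (Hist M.Precedes)) :=
  {L | (∃ w, m = M.root w ∧ M.history ⁻¹' L ∈ M.Choice a w) ∨
    ∃ w, m = .inr w ∧ L = {M.history w}}

/-- Indistinguishability: that of the Kripke model at roots, and equality at leaves. -/
def treeEpi (a : Agent) (i j : Idx M.Precedes) : Prop :=
  i = j ∨ ∃ w v, i = M.idx w ∧ j = M.idx v ∧ M.aeq a w v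

variable {M}

theorem mem_treeChoice_root {a : Agent} {w : M.W} {L : Set (Hist M.Precedes)} :
    L ∈ M.treeChoice a (M.root w) ↔ M.history ⁻¹' L ∈ M.Choice a w := by
  constructor
  · rintro (⟨v, hv, hL⟩ | ⟨v, hv, -⟩)
    · rwa [M.choice_congr a w v (root_eq_root.1 hv)]
    · cases hv
  · exact fun hL => .inl ⟨w, rfl, hL⟩

theorem mem_treeChoice_leaf {a : Agent} {w : M.W} {L : Set (Hist M.Precedes)} :
    L ∈ M.treeChoice a (.inr w) ↔ L = {M.history w} := by
  constructor
  · rintro (⟨v, hv, hL⟩ | ⟨v, hv, hL⟩)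
    · cases hv
    · cases hv; exact hL
  · exact fun hL => .inr ⟨w, rfl, hL⟩

theorem preimage_history_image (K : Set M.W) : M.history ⁻¹' (M.history '' K) = K :=
  Set.preimage_image_eq K history_injective

theorem forall_treeChoice_root {a : Agent} {w : M.W} {P : Set M.W → Prop} :
    (∀ L ∈ M.treeChoice a (M.root w), P (M.history ⁻¹' L)) ↔ ∀ K ∈ M.Choice a w, P K := by
  simp only [mem_treeChoice_root]
  exact (history_injective.preimage_surjective.forall
    (p := fun K => K ∈ M.Choice a w → P K)).symm

theorem exists_treeChoice_root {a : Agent} {w : M.W} {P : Set M.W → Prop} :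
    (∃ L ∈ M.treeChoice a (M.root w), P (M.history ⁻¹' L)) ↔ ∃ K ∈ M.Choice a w, P K := by
  simp only [mem_treeChoice_root]
  exact (history_injective.preimage_surjective.exists
    (p := fun K => K ∈ M.Choice a w ∧ P K)).symm

theorem treeEpi_idx {a : Agent} {w v : M.W} : M.treeEpi a (M.idx w) (M.idx v) ↔ M.aeq a w v := by
  constructor
  · rintro (h | ⟨w', v', hw, hv, h⟩)
    · rw [idx_injective h]; exact (M.aeq_equiv a).refl v
    · rwa [idx_injective hw, idx_injective hv]
  · exact fun h => .inr ⟨w, v, rfl, rfl, h⟩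

theorem treeEpi_mk {a : Agent} {w w' v v' : M.W} (p : M.root w ∈ (M.history v).val)
    (q : M.root w' ∈ (M.history v').val) :
    M.treeEpi a ⟨M.root w, M.history v, p⟩ ⟨M.root w', M.history v', q⟩ ↔ M.aeq a v v' := by
  rw [mk_root_history, mk_root_history, treeEpi_idx]

theorem treeEpi_idx_left {a : Agent} {w : M.W} {j : Idx M.Precedes} :
    M.treeEpi a (M.idx w) j ↔ ∃ v, j = M.idx v ∧ M.aeq a w v := by
  constructor
  · rintro (rfl | ⟨w', v', hw, rfl, h⟩)
    · exact ⟨w, rfl, (M.aeq_equiv a).refl w⟩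
    · exact ⟨v', rfl, idx_injective hw ▸ h⟩
  · rintro ⟨v, rfl, h⟩; exact treeEpi_idx.2 h

theorem treeEpi_leafIdx_left {a : Agent} {w : M.W} {j : Idx M.Precedes} :
    M.treeEpi a (M.leafIdx w) j ↔ j = M.leafIdx w := by
  constructor
  · rintro (rfl | ⟨w', v', hw, -⟩)
    · rfl
    · exact (idx_ne_leafIdx hw.symm).elim
  · rintro rfl; exact .inl rfl

theorem treeEpi_equivalence (a : Agent) : Equivalence (M.treeEpi a) where
  refl i := .inl rfl
  symm := by
    rintro i j (rfl | ⟨w, v, rfl, rfl, h⟩)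
    · exact .inl rfl
    · exact treeEpi_idx.2 ((M.aeq_equiv a).symm h)
  trans := by
    rintro i j k (rfl | ⟨w, v, rfl, rfl, h⟩) hjk
    · exact hjk
    · obtain ⟨u, rfl, hu⟩ := treeEpi_idx_left.1 hjk
      exact treeEpi_idx.2 ((M.aeq_equiv a).trans h hu)

theorem mem_exAnte_idx [Nonempty M.W] {a : Agent} {w : M.W} {j : Idx M.Precedes} :
    j ∈ exAnte M.treeEpi a (M.idx w) ↔
      ∃ x, j = M.idx x ∧ ∃ y, M.aeq a w y ∧ M.rbox y x := by
  constructor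
  · rintro ⟨h, p, hj⟩
    obtain ⟨y, hy, hwy⟩ := treeEpi_idx_left.1 hj
    have hm : j.mom = M.root y := congrArg Idx.mom hy
    obtain ⟨x, hx, rfl⟩ := eq_idx_of_mom hm
    exact ⟨x, rfl, y, hwy, hx⟩
  · rintro ⟨x, rfl, y, hwy, hyx⟩
    exact ⟨M.history y, root_mem_history.2 (M.rbox_equiv.symm hyx), (treeEpi_mk _ _).2 hwy⟩

theorem eq_leafIdx_of_mem_exAnte [Nonempty M.W] {a : Agent} {w : M.W} {j : Idx M.Precedes}
    (hj : j ∈ exAnte M.treeEpi a (M.leafIdx w)) : j = M.leafIdx w := by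
  obtain ⟨h, p, hj⟩ := hj
  exact eq_leafIdx_of_mom (congrArg Idx.mom (treeEpi_leafIdx_left.1 hj))

theorem exists_aeq_rbox_trans {a : Agent} {w x y : M.W}
    (hx : ∃ u, M.aeq a w u ∧ M.rbox u x) (hy : ∃ u, M.aeq a x u ∧ M.rbox u y) :
    ∃ u, M.aeq a w u ∧ M.rbox u y := by
  obtain ⟨u, hwu, hux⟩ := hx
  obtain ⟨v, hxv, hvy⟩ := hy
  obtain ⟨z, hvz, huz⟩ := M.unifHK a x v hxv u (M.rbox_equiv.symm hux)
  exact ⟨z, (M.aeq_equiv a).trans hwu huz, M.rbox_equiv.trans (M.rbox_equiv.symm hvz) hvy⟩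

theorem exists_aeq_rbox_symm {a : Agent} {w x : M.W}
    (hx : ∃ u, M.aeq a w u ∧ M.rbox u x) : ∃ u, M.aeq a x u ∧ M.rbox u w := by
  obtain ⟨u, hwu, hux⟩ := hx
  obtain ⟨z, hwz, hxz⟩ := M.unifHK a u w ((M.aeq_equiv a).symm hwu) x hux
  exact ⟨z, hxz, M.rbox_equiv.symm hwz⟩

variable (M)

/-- The intention topology: the upward closed subsets of the ex ante information set. -/
def treeTau (a : Agent) (i : Idx M.Precedes) : Set (Set (Idx M.Precedes)) :=
  {U | U ⊆ exAnte M.treeEpi a i ∧ ∀ w v, M.ri a w v → M.idx w ∈ U → M.idx v ∈ U}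

variable {M}

theorem exAnte_mem_treeTau [Nonempty M.W] (a : Agent) (i : Idx M.Precedes) :
    exAnte M.treeEpi a i ∈ M.treeTau a i := by
  refine ⟨subset_rfl, fun w v hwv hw => ?_⟩
  rcases idx_cases i with ⟨u, rfl⟩ | ⟨u, rfl⟩
  · obtain ⟨x, hx, hux⟩ := mem_exAnte_idx.1 hw
    cases idx_injective hx
    exact mem_exAnte_idx.2 ⟨v, rfl, exists_aeq_rbox_trans hux (M.ri_sub a hwv)⟩
  · exact (idx_ne_leafIdx (eq_leafIdx_of_mem_exAnte hw)).elim

theorem treeTau_inter_nonempty [Nonempty M.W] {a : Agent} {i : Idx M.Precedes}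
    {U V : Set (Idx M.Precedes)} (hU : U ∈ M.treeTau a i) (hV : V ∈ M.treeTau a i)
    (hUne : U.Nonempty) (hVne : V.Nonempty) : (U ∩ V).Nonempty := by
  obtain ⟨j, hj⟩ := hUne
  obtain ⟨k, hk⟩ := hVne
  rcases idx_cases i with ⟨w, rfl⟩ | ⟨w, rfl⟩
  · obtain ⟨x, rfl, hx⟩ := mem_exAnte_idx.1 (hU.1 hj)
    obtain ⟨y, rfl, hy⟩ := mem_exAnte_idx.1 (hV.1 hk)
    obtain ⟨z, hxz, hyz⟩ := M.denK a x y (exists_aeq_rbox_trans (exists_aeq_rbox_symm hx) hy)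
    exact ⟨M.idx z, hU.2 x z hxz hj, hV.2 y z hyz hk⟩
  · obtain rfl := eq_leafIdx_of_mem_exAnte (hU.1 hj)
    obtain rfl := eq_leafIdx_of_mem_exAnte (hV.1 hk)
    exact ⟨_, hj, hk⟩

theorem treeChoice_iInter_nonempty [Nonempty M.W] (m : M.Moment)
    (s : Agent → Set (Hist M.Precedes)) (hs : ∀ a, s a ∈ M.treeChoice a m) :
    (⋂ a, s a).Nonempty := by
  rcases moment_cases m with ⟨w, rfl⟩ | ⟨w, rfl⟩
  · obtain ⟨x, hx⟩ := M.ia w (fun a => M.history ⁻¹' s a) fun a => mem_treeChoice_root.1 (hs a)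
    exact ⟨M.history x, by simpa using hx⟩
  · refine ⟨M.history w, Set.mem_iInter.2 fun a => ?_⟩
    rw [mem_treeChoice_leaf.1 (hs a)]
    rfl

theorem mem_of_mem_treeChoice [Nonempty M.W] {a : Agent} {m : M.Moment}
    {L : Set (Hist M.Precedes)} (hL : L ∈ M.treeChoice a m) {h : Hist M.Precedes} (hh : h ∈ L) :
    m ∈ h.val := by
  rcases moment_cases m with ⟨w, rfl⟩ | ⟨w, rfl⟩
  · obtain ⟨v, rfl⟩ := history_surjective h
    exact root_mem_history.2 (M.choice_sub a w _ (mem_treeChoice_root.1 hL) v hh)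
  · rw [mem_treeChoice_leaf.1 hL] at hh
    obtain rfl := hh
    exact leaf_mem_history.2 rfl

variable (M)

/-- The branching-time model on the two-level tree over a Kripke model. -/
noncomputable def toKiobt [Nonempty M.W] : BiKiobtModel Agent M.Moment M.Precedes where
  ags_fin := M.ags_fin
  mom_ne := ⟨.inr (Classical.arbitrary _)⟩
  lt_irrefl := by rintro m ⟨w, rfl, h⟩; cases h
  lt_trans := by rintro m₁ m₂ m₃ ⟨w, rfl, rfl⟩ ⟨v, h, -⟩; cases h
  no_bb := by rintro m₁ m₂ m ⟨w, rfl, rfl⟩ ⟨v, rfl, h⟩; cases h; exact .inl rfl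
  Choice := M.treeChoice
  choice_sub a m L hL h hh := mem_of_mem_treeChoice hL hh
  choice_ne a m L hL := by
    rcases moment_cases m with ⟨w, rfl⟩ | ⟨w, rfl⟩
    · obtain ⟨v, hv⟩ := M.choice_ne a w _ (mem_treeChoice_root.1 hL)
      exact ⟨_, hv⟩
    · rw [mem_treeChoice_leaf.1 hL]; exact Set.singleton_nonempty _
  choice_cover a m h p := by
    rcases moment_cases m with ⟨w, rfl⟩ | ⟨w, rfl⟩
    · obtain ⟨v, hv, rfl⟩ := exists_history_of_root_mem p
      obtain ⟨K, hK, hvK⟩ := M.choice_cover a w v hv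
      refine ⟨M.history '' K, mem_treeChoice_root.2 ?_, v, hvK, rfl⟩
      rwa [preimage_history_image]
    · exact ⟨_, mem_treeChoice_leaf.2 rfl, eq_history_of_leaf_mem p⟩
  choice_disj a m L hL L' hL' h hh hh' := by
    rcases moment_cases m with ⟨w, rfl⟩ | ⟨w, rfl⟩
    · obtain ⟨v, rfl⟩ := history_surjective h
      exact history_surjective.preimage_injective (M.choice_disj a w _ (mem_treeChoice_root.1 hL)
        _ (mem_treeChoice_root.1 hL') v hh hh')
    · rw [mem_treeChoice_leaf.1 hL, mem_treeChoice_leaf.1 hL']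
  nc := by
    rintro a m m' ⟨w, rfl, rfl⟩ h h' - - p p' L - hL
    rwa [eq_history_of_leaf_mem p', ← eq_history_of_leaf_mem p]
  ia := treeChoice_iInter_nonempty
  epi := M.treeEpi
  epi_equiv := treeEpi_equivalence
  oac := by
    intro a i j hij L hL hi h' hh' p
    refine (treeEpi_equivalence a).trans ?_ hij
    rcases idx_cases i with ⟨w, rfl⟩ | ⟨w, rfl⟩
    · obtain ⟨v, -, rfl⟩ := exists_history_of_root_mem p
      exact (treeEpi_mk _ _).2
        ((M.aeq_equiv a).symm (M.oacK a w _ (mem_treeChoice_root.1 hL) hi v hh'))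
    · exact .inl (eq_leafIdx_of_mom rfl)
  unifH := by
    intro a i j hij h' p
    rcases idx_cases i with ⟨w, rfl⟩ | ⟨w, rfl⟩
    · obtain ⟨v, rfl, hwv⟩ := treeEpi_idx_left.1 hij
      obtain ⟨w', hw', rfl⟩ := exists_history_of_root_mem p
      obtain ⟨v', hv', h⟩ := M.unifHK a w v hwv w' hw'
      exact ⟨M.history v', root_mem_history.2 hv', (treeEpi_mk _ _).2 h⟩
    · obtain rfl := treeEpi_leafIdx_left.1 hij
      exact ⟨h', p, .inl rfl⟩
  tau := M.treeTau
  tau_sub a i U hU := hU.1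
  tau_univ := exAnte_mem_treeTau
  tau_empty a i := ⟨Set.empty_subset _, fun _ _ _ h => h⟩
  tau_inter a i U V hU hV :=
    ⟨fun _ hj => hU.1 hj.1, fun w v hwv hw => ⟨hU.2 w v hwv hw.1, hV.2 w v hwv hw.2⟩⟩
  tau_sUnion a i S hS :=
    ⟨Set.sUnion_subset fun U hU => (hS hU).1, fun w v hwv ⟨U, hU, hw⟩ =>
      ⟨U, hU, (hS hU).2 w v hwv hw⟩⟩
  tau_ci a i U V := treeTau_inter_nonempty
  tau_ki a i j h := by simp only [treeTau, h]
  ValueO h := M.ValueO (Function.surjInv history_surjective h)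
  ValueS h := M.ValueS (Function.surjInv history_surjective h)
  val n := M.idx '' M.val n

variable {M}

section Transfer

variable [Nonempty M.W] {a : Agent} {w v : M.W} {L L' : Set (Hist M.Precedes)}

theorem toKiobt_finiteChoice (hfc : ∀ a w, (M.Choice a w).Finite) : FiniteChoice M.toKiobt := by
  intro a m
  change (M.treeChoice a m).Finite
  rcases moment_cases m with ⟨w, rfl⟩ | ⟨w, rfl⟩
  · refine ((hfc a w).preimage history_surjective.preimage_injective.injOn).subset ?_
    exact fun L hL => mem_treeChoice_root.1 hL
  · exact (Set.finite_singleton {M.history w}).subset fun L hL => mem_treeChoice_leaf.1 hL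

theorem toKiobt_valueO_history (w : M.W) : M.toKiobt.ValueO (M.history w) = M.ValueO w :=
  congrArg M.ValueO (Function.leftInverse_surjInv ⟨history_injective, history_surjective⟩ w)

theorem toKiobt_valueS_history (w : M.W) : M.toKiobt.ValueS (M.history w) = M.ValueS w :=
  congrArg M.ValueS (Function.leftInverse_surjInv ⟨history_injective, history_surjective⟩ w)

theorem leVal_toKiobt {X Y : Set (Hist M.Precedes)} :
    leVal M.toKiobt X Y ↔ kleO M (M.history ⁻¹' X) (M.history ⁻¹' Y) := by
  simp only [leVal, kleO, history_surjective.forall, toKiobt_valueO_history, Set.mem_preimage]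

theorem leValS_toKiobt {X Y : Set (Hist M.Precedes)} :
    leValS M.toKiobt X Y ↔ kleS M (M.history ⁻¹' X) (M.history ⁻¹' Y) := by
  simp only [leValS, kleS, history_surjective.forall, toKiobt_valueS_history, Set.mem_preimage]

theorem mem_stateSet_toKiobt {S : Set (Hist M.Precedes)} :
    S ∈ stateSet M.toKiobt a (M.root w) ↔ M.history ⁻¹' S ∈ kState M a w := by
  constructor
  · rintro ⟨s, hs, rfl⟩
    exact ⟨fun b => M.history ⁻¹' s b, fun b => mem_treeChoice_root.1 (hs b),
      by simp only [Set.preimage_iInter]⟩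
  · rintro ⟨s, hs, hS⟩
    refine ⟨fun b => M.history '' s b, fun b => mem_treeChoice_root.2 ?_,
      history_surjective.preimage_injective ?_⟩
    · rw [preimage_history_image]; exact hs b
    · simp only [Set.preimage_iInter, preimage_history_image, hS]

theorem forall_stateSet_toKiobt {P : Set M.W → Prop} :
    (∀ S ∈ stateSet M.toKiobt a (M.root w), P (M.history ⁻¹' S)) ↔ ∀ S ∈ kState M a w, P S := by
  simp only [mem_stateSet_toKiobt]
  exact (history_injective.preimage_surjective.forall
    (p := fun K => K ∈ kState M a w → P K)).symm

theorem domO_toKiobt :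
    domO M.toKiobt a (M.root w) L L' ↔ kdom M a w (M.history ⁻¹' L) (M.history ⁻¹' L') := by
  simp only [domO, leVal_toKiobt, Set.preimage_inter]
  exact forall_stateSet_toKiobt
    (P := fun S => kleO M (M.history ⁻¹' L ∩ S) (M.history ⁻¹' L' ∩ S))

theorem momRel_toKiobt {m : M.Moment} :
    momRel M.toKiobt a (M.root w) m ↔ ∃ v, M.aeq a w v ∧ m = M.root v := by
  constructor
  · rintro ⟨i, j, hi, rfl, hij⟩
    obtain ⟨x, hx, rfl⟩ := eq_idx_of_mom hi
    obtain ⟨y, rfl, hxy⟩ := treeEpi_idx_left.1 hij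
    obtain ⟨v, hv, hwv⟩ := M.unifHK a x y hxy w (M.rbox_equiv.symm hx)
    exact ⟨v, hwv, root_eq_root.2 hv⟩
  · rintro ⟨v, hv, rfl⟩
    exact ⟨M.idx w, M.idx v, rfl, rfl, treeEpi_idx.2 hv⟩

theorem forall_momRel_toKiobt {P : M.Moment → Prop} :
    (∀ m, momRel M.toKiobt a (M.root w) m → P m) ↔ ∀ v, M.aeq a w v → P (M.root v) := by
  simp only [momRel_toKiobt]
  exact ⟨fun h v hv => h _ ⟨v, hv, rfl⟩, by rintro h _ ⟨v, hv, rfl⟩; exact h v hv⟩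

theorem preimage_cluster_toKiobt (hL : L ∈ M.treeChoice a (M.root w)) :
    M.history ⁻¹' cluster M.toKiobt a (M.root w) L (M.root v) =
      kcluster M a (M.history ⁻¹' L) v := by
  ext u
  constructor
  · rintro ⟨p, h, hL, q, he⟩
    obtain ⟨o, -, rfl⟩ := exists_history_of_root_mem q
    exact ⟨root_mem_history.1 p, o, hL, (treeEpi_mk _ _).1 he⟩
  · rintro ⟨hvu, o, ho, hou⟩
    exact ⟨root_mem_history.2 hvu, M.history o, ho, mem_of_mem_treeChoice hL ho,
      (treeEpi_mk _ _).2 hou⟩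

theorem domS_toKiobt (hL : L ∈ M.treeChoice a (M.root w)) (hL' : L' ∈ M.treeChoice a (M.root w)) :
    domS M.toKiobt a (M.root w) L L' ↔ kdomS M a w (M.history ⁻¹' L) (M.history ⁻¹' L') := by
  simp only [domS, kdomS, forall_momRel_toKiobt, leValS_toKiobt, Set.preimage_inter,
    preimage_cluster_toKiobt hL, preimage_cluster_toKiobt hL']
  refine forall₂_congr fun v _ => forall_stateSet_toKiobt
    (P := fun S => kleS M (kcluster M a (M.history ⁻¹' L) v ∩ S)
      (kcluster M a (M.history ⁻¹' L') v ∩ S))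

theorem mem_optimal_toKiobt :
    L ∈ optimal M.toKiobt a (M.root w) ↔ L ∈ M.treeChoice a (M.root w) ∧
      ¬ ∃ K ∈ M.Choice a w, kdom M a w (M.history ⁻¹' L) K ∧ ¬ kdom M a w K (M.history ⁻¹' L) := by
  rw [← exists_treeChoice_root]
  simp only [← domO_toKiobt]
  rfl

theorem mem_soptimal_toKiobt :
    L ∈ soptimal M.toKiobt a (M.root w) ↔ L ∈ M.treeChoice a (M.root w) ∧
      ¬ ∃ K ∈ M.Choice a w,
        kdomS M a w (M.history ⁻¹' L) K ∧ ¬ kdomS M a w K (M.history ⁻¹' L) := by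
  rw [← exists_treeChoice_root]
  refine and_congr_right fun hL => not_congr (exists_congr fun L' => and_congr_right fun hL' => ?_)
  rw [← domS_toKiobt hL hL', ← domS_toKiobt hL' hL]
  rfl

theorem forall_mem_at_root {X : Set (Hist M.Precedes)}
    (hX : ∀ h ∈ X, M.root w ∈ h.val) {P : Idx M.Precedes → Prop} :
    (∀ h ∈ X, ∀ p : M.root w ∈ h.val, P ⟨M.root w, h, p⟩) ↔
      ∀ v ∈ M.history ⁻¹' X, P (M.idx v) := by
  rw [history_surjective.forall]
  refine forall₂_congr fun v hv => ?_
  rw [← mk_root_history (hX _ hv)]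
  exact ⟨fun h => h _, fun h _ => h⟩

theorem ktruth_iff_truth_toKiobt (hfc : ∀ a w, (M.Choice a w).Finite) (φ : Formula Agent)
    (w : M.W) : ktruth M φ w ↔ truth M.toKiobt φ (M.idx w) := by
  induction φ generalizing w with
  | atom n => exact (idx_injective.mem_set_image).symm
  | neg φ ih => exact not_congr (ih w)
  | conj φ ψ ihφ ihψ => exact and_congr (ihφ w) (ihψ w)
  | box φ ih =>
    simp only [ktruth, ih]
    exact forall_at_root.symm
  | stit a φ ih =>
    simp only [ktruth, ih]
    rw [← forall_treeChoice_root]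
    exact forall₂_congr fun L hL => imp_congr_right fun _ =>
      (forall_mem_at_root fun h => mem_of_mem_treeChoice hL).symm
  | know a φ ih =>
    simp only [ktruth, ih]
    constructor
    · intro h j hj
      obtain ⟨v, rfl, hv⟩ := treeEpi_idx_left.1 hj
      exact h v hv
    · exact fun h v hv => h _ (treeEpi_idx.2 hv)
  | intend a φ ih =>
    simp only [ktruth, ih]
    constructor
    · rintro ⟨x, hx, h⟩
      refine ⟨M.idx '' {v | x = v ∨ M.ri a x v}, ⟨?_, ?_⟩, ⟨_, x, .inl rfl, rfl⟩, ?_⟩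
      · rintro _ ⟨v, rfl | hv, rfl⟩
        · exact mem_exAnte_idx.2 ⟨_, rfl, hx⟩
        · exact mem_exAnte_idx.2 ⟨_, rfl, exists_aeq_rbox_trans hx (M.ri_sub a hv)⟩
      · rintro u v huv ⟨u', hu', he⟩
        cases idx_injective he
        refine ⟨v, .inr ?_, rfl⟩
        rcases hu' with rfl | hu'
        · exact huv
        · exact M.ri_trans a hu' huv
      · rintro _ ⟨v, hv, rfl⟩
        exact h v hv
    · rintro ⟨U, hU, ⟨j, hj⟩, h⟩
      obtain ⟨x, rfl, hx⟩ := mem_exAnte_idx.1 (hU.1 hj)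
      refine ⟨x, hx, ?_⟩
      rintro v (rfl | hv)
      · exact h _ hj
      · exact h _ (hU.2 x v hv hj)
  | oughtO a φ ih =>
    rw [ktruth_oughtO_iff hfc]
    simp only [ih]
    rw [← forall_treeChoice_root]
    refine forall_congr' fun L => Iff.trans ?_ (imp_congr_left mem_optimal_toKiobt.symm)
    rw [and_imp]
    exact forall₂_congr fun hL _ => (forall_mem_at_root fun h => mem_of_mem_treeChoice hL).symm
  | oughtS a φ ih =>
    rw [ktruth_oughtS_iff hfc]
    simp only [ih]
    rw [← forall_treeChoice_root]
    refine forall_congr' fun L => Iff.trans ?_ (imp_congr_left mem_soptimal_toKiobt.symm)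
    rw [and_imp]
    refine forall₂_congr fun hL _ => Iff.trans ?_ forall_momRel_toKiobt.symm
    refine forall₂_congr fun v _ => ?_
    rw [← preimage_cluster_toKiobt hL]
    exact (forall_mem_at_root fun h hh => hh.1).symm

end Transfer

/-- The Kripke model with a single world. -/
def onePoint (Agent : Type) [Finite Agent] : KripkeModel Agent where
  W := Unit
  ags_fin := inferInstance
  rbox _ _ := True
  rbox_equiv := ⟨fun _ => True.intro, fun h => h, fun h _ => h⟩
  Choice _ _ := {Set.univ}
  choice_congr _ _ _ _ := rfl
  choice_sub _ _ _ _ _ _ := True.intro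
  choice_ne := by rintro _ _ _ rfl; exact Set.univ_nonempty
  choice_cover _ _ _ _ := ⟨_, rfl, Set.mem_univ _⟩
  choice_disj := by rintro _ _ _ rfl _ rfl _ _ _; rfl
  ia _ s hs := ⟨(), Set.mem_iInter.2 fun a => (hs a).symm ▸ Set.mem_univ _⟩
  aeq _ _ _ := True
  aeq_equiv _ := ⟨fun _ => True.intro, fun h => h, fun h _ => h⟩
  oacK _ _ _ _ _ _ _ := True.intro
  unifHK _ _ _ _ _ _ := ⟨(), True.intro, True.intro⟩
  ri _ _ _ := True
  ri_serial _ _ := ⟨(), True.intro⟩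
  ri_trans _ _ _ _ _ _ := True.intro
  ri_eucl _ _ _ _ _ _ := True.intro
  ri_sub _ _ _ _ := ⟨(), True.intro, True.intro⟩
  denK _ _ _ _ := ⟨(), True.intro, True.intro⟩
  ValueO _ := 0
  ValueS _ := 0
  val _ := ∅

end KripkeModel

/-- truth-preserving correspondence between bi-valued
Kripke-kios-models (with finite choice partitions) and finite-choice
bi-valued kiobt-models. -/
theorem kripke_to_kiobt_correspondence {Agent : Type} (M : KripkeModel Agent)
    (hfc : ∀ a w, (M.Choice a w).Finite) :
    ∃ (Mom : Type) (lt : Mom → Mom → Prop) (MT : BiKiobtModel Agent Mom lt),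
      FiniteChoice MT ∧ ∃ g : M.W → Idx lt,
        ∀ (φ : Formula Agent) (w : M.W), ktruth M φ w ↔ truth MT φ (g w) := by
  rcases isEmpty_or_nonempty M.W with hW | hW
  · have := M.ags_fin
    have : Nonempty (KripkeModel.onePoint Agent).W := ⟨()⟩
    exact ⟨_, _, (KripkeModel.onePoint Agent).toKiobt,
      KripkeModel.toKiobt_finiteChoice fun _ _ => Set.finite_singleton _,
      fun w => hW.elim w, fun _ w => hW.elim w⟩
  · exact ⟨_, _, M.toKiobt, KripkeModel.toKiobt_finiteChoice hfc, M.idx,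
      KripkeModel.ktruth_iff_truth_toKiobt hfc⟩

end IEAUST
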